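/- Fix full-dimensional polytopes P₁, …, P_k ⊆ ℝⁿ with 0 in the interior of the Minkowski sum P₁ + … + P_k, vectors V₁, …, V_k ∈ ℝⁿ with Σ_i A_{P_i}(V_i) = 0, and the reference functions h_i as below. Then for every t₀ ∈ (0,1] there exists a constant C such that for every t ∈ [t₀, 1] and every solution (f₁, …, f_k) of the continuity system at time t, the infimum m := inf_{ℝⁿ} Σ_{i=1}^k (t f_i + (1−t) h_i) satisfies |m| ≤ C. -/

import Mathlib

open scoped RealInnerProductSpace Pointwise
open MeasureTheory

/-- The `V`-weighted volume `Vol_V(P) = ∫_P e^{⟨V,p⟩} dp`. -/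
noncomputable def weightedVol {n : ℕ} (P : Set (EuclideanSpace ℝ (Fin n)))
    (V : EuclideanSpace ℝ (Fin n)) : ℝ :=
  ∫ p in P, Real.exp ⟪V, p⟫

/-- The weighted barycenter `A_P(V) = Vol_V(P)⁻¹ ∫_P p e^{⟨V,p⟩} dp`. -/
noncomputable def weightedBary {n : ℕ} (P : Set (EuclideanSpace ℝ (Fin n)))
    (V : EuclideanSpace ℝ (Fin n)) : EuclideanSpace ℝ (Fin n) :=
  (weightedVol P V)⁻¹ • ∫ p in P, Real.exp ⟪V, p⟫ • p

/-- The Hessian determinant `det (D²f(x))`. -/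
noncomputable def hessDet {n : ℕ} (f : EuclideanSpace ℝ (Fin n) → ℝ)
    (x : EuclideanSpace ℝ (Fin n)) : ℝ :=
  LinearMap.det (fderiv ℝ (gradient f) x).toLinearMap

section ConvexGradient

variable {E : Type*} [NormedAddCommGroup E] [InnerProductSpace ℝ E]

theorem ConvexOn.add_inner_gradient_le [CompleteSpace E] {f : E → ℝ}
    (hf : ConvexOn ℝ Set.univ f) {z : E}
    (hd : DifferentiableAt ℝ f z) (x : E) : f z + ⟪gradient f z, x - z⟫ ≤ f x := by
  have hφ : ConvexOn ℝ Set.univ (f ∘ AffineMap.lineMap (k := ℝ) z x) := by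
    simpa using hf.comp_affineMap (AffineMap.lineMap (k := ℝ) z x)
  have hd' : HasDerivAt (f ∘ AffineMap.lineMap (k := ℝ) z x) ⟪gradient f z, x - z⟫ 0 := by
    have h1 : HasFDerivAt f (fderiv ℝ f z) (AffineMap.lineMap (k := ℝ) z x 0) := by
      simpa using hd.hasFDerivAt
    have h2 := h1.comp_hasDerivAt (0 : ℝ)
      (AffineMap.hasDerivAt_lineMap (a := z) (b := x) (x := (0 : ℝ)))
    rwa [← inner_gradient_left] at h2
  have := hφ.le_slope_of_hasDerivAt (Set.mem_univ 0) (Set.mem_univ 1) one_pos hd'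
  simp only [slope_def_field, Function.comp_apply, AffineMap.lineMap_apply_zero,
    AffineMap.lineMap_apply_one, sub_zero, div_one] at this
  linarith

theorem StrictConvexOn.gradient_injective [CompleteSpace E] {f : E → ℝ}
    (hf : StrictConvexOn ℝ Set.univ f)
    (hd : Differentiable ℝ f) : Function.Injective (gradient f) := by
  intro x y hxy
  by_contra hne
  have hmid := hf.2 (Set.mem_univ x) (Set.mem_univ y) hne
    (show (0 : ℝ) < 1 / 2 by norm_num) (show (0 : ℝ) < 1 / 2 by norm_num) (by norm_num)
  have h1 := hf.convexOn.add_inner_gradient_le (hd x) ((1 / 2 : ℝ) • x + (1 / 2 : ℝ) • y)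
  have h2 := hf.convexOn.add_inner_gradient_le (hd y) ((1 / 2 : ℝ) • x + (1 / 2 : ℝ) • y)
  rw [show (1 / 2 : ℝ) • x + (1 / 2 : ℝ) • y - x = (1 / 2 : ℝ) • (y - x) by module] at h1
  rw [← hxy, show (1 / 2 : ℝ) • x + (1 / 2 : ℝ) • y - y = - ((1 / 2 : ℝ) • (y - x)) by module,
    inner_neg_right] at h2
  simp only [smul_eq_mul] at hmid
  linarith

/-- A finite subset of a ball all of whose small perturbations detect the norm. -/
theorem exists_finset_inner_ge [FiniteDimensional ℝ E] (p : E) {r : ℝ} (hr : 0 < r) :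
    ∃ T : Finset E, (∀ y ∈ T, y ∈ Metric.closedBall p r) ∧
      ∀ q : E → E, (∀ y ∈ T, dist (q y) y ≤ r / 4) →
        ∀ v : E, ∃ y ∈ T, ⟪p, v⟫ + r / 2 * ‖v‖ ≤ ⟪q y, v⟫ := by
  obtain ⟨t, hts, htf, hcov⟩ := (isCompact_closedBall p r).finite_cover_balls
    (show 0 < r / 4 by positivity)
  refine ⟨htf.toFinset, fun y hy => hts (by simpa using hy), fun q hq v => ?_⟩
  set u : E := (r * ‖v‖⁻¹) • v with hu
  have hun : ‖u‖ ≤ r := by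
    rw [hu, norm_smul, Real.norm_of_nonneg (by positivity), mul_assoc]
    exact mul_le_of_le_one_right hr.le (inv_mul_le_one)
  have huv : ⟪u, v⟫ = r * ‖v‖ := by
    rw [hu, real_inner_smul_left, real_inner_self_eq_norm_sq]
    rcases eq_or_ne ‖v‖ 0 with h0 | h0
    · simp [h0]
    · field_simp
  have hmem : p + u ∈ Metric.closedBall p r := by simpa [Metric.mem_closedBall, dist_eq_norm]
  obtain ⟨y, hy, hyu⟩ := Set.mem_iUnion₂.1 (hcov hmem)
  have hyT : y ∈ htf.toFinset := by simpa using hy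
  refine ⟨y, hyT, ?_⟩
  have hd : ‖p + u - q y‖ ≤ r / 2 := by
    rw [← dist_eq_norm]
    have := dist_triangle (p + u) y (q y)
    have h1 := hq y hyT
    rw [dist_comm] at h1
    have h2 := Metric.mem_ball.1 hyu
    linarith
  have h3 := (real_inner_le_norm (p + u - q y) v).trans
    (mul_le_mul_of_nonneg_right hd (norm_nonneg v))
  rw [inner_sub_left, inner_add_left, huv] at h3
  linarith

theorem ConvexOn.interior_closure_range_gradient_subset [FiniteDimensional ℝ E] {f : E → ℝ}
    (hf : ConvexOn ℝ Set.univ f) (hd : Differentiable ℝ f) :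
    interior (closure (Set.range (gradient f))) ⊆ Set.range (gradient f) := by
  intro p hp
  obtain ⟨r, hr, hball⟩ := Metric.nhds_basis_closedBall.mem_iff.1 (mem_interior_iff_mem_nhds.1 hp)
  obtain ⟨T, hT, hTq⟩ := exists_finset_inner_ge p hr
  have hz : ∀ y : E, ∃ z, y ∈ T → dist (gradient f z) y ≤ r / 4 := by
    intro y
    by_cases hy : y ∈ T
    · obtain ⟨_, ⟨z, rfl⟩, hz⟩ := Metric.mem_closure_iff.1 (hball (hT y hy)) (r / 4)
        (by positivity)
      exact ⟨z, fun _ => by rw [dist_comm]; exact hz.le⟩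
    · exact ⟨0, fun h => absurd h hy⟩
  choose z hz using hz
  have hlow : ∀ x, r / 2 * ‖x‖ + (-∑ y ∈ T, |f (z y) - ⟪gradient f (z y), z y⟫|)
      ≤ f x - ⟪p, x⟫ := by
    intro x
    obtain ⟨y, hy, hyx⟩ := hTq (fun y => gradient f (z y)) hz x
    have h1 := hf.add_inner_gradient_le (hd (z y)) x
    rw [inner_sub_right] at h1
    have h2 := Finset.single_le_sum
      (f := fun y => |f (z y) - ⟪gradient f (z y), z y⟫|) (fun i _ => abs_nonneg _) hy
    have h3 := neg_abs_le (f (z y) - ⟪gradient f (z y), z y⟫)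
    linarith
  have hlim : Filter.Tendsto (fun x => f x - ⟪p, x⟫) (Filter.cocompact E) Filter.atTop := by
    refine Filter.tendsto_atTop_mono hlow (Filter.tendsto_atTop_add_const_right _ _ ?_)
    exact (tendsto_norm_cocompact_atTop (E := E)).const_mul_atTop (by positivity)
  have hcont : Continuous fun x => f x - ⟪p, x⟫ := by
    have := hd.continuous
    fun_prop
  obtain ⟨x, hx⟩ := hcont.exists_forall_le hlim
  refine ⟨x, ?_⟩
  have hmin : IsLocalMin (fun x => f x - ⟪p, x⟫) x := Filter.Eventually.of_forall hx
  have hfd : HasFDerivAt (fun x => f x - ⟪p, x⟫) (fderiv ℝ f x - innerSL ℝ p) x :=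
    (hd x).hasFDerivAt.sub (innerSL ℝ p).hasFDerivAt
  have h0 := hmin.hasFDerivAt_eq_zero hfd
  refine ext_inner_right ℝ fun v => ?_
  have := DFunLike.congr_fun h0 v
  simp at this
  rw [inner_gradient_left]
  linarith

end ConvexGradient

section Transport

variable {n : ℕ}

theorem differentiable_gradient_of_contDiff {f : EuclideanSpace ℝ (Fin n) → ℝ}
    (hf : ContDiff ℝ (⊤ : ℕ∞) f) : Differentiable ℝ (gradient f) := by
  have h1 : Differentiable ℝ (fderiv ℝ f) :=
    (hf.fderiv_right (m := (⊤ : ℕ∞)) (by simp)).differentiable (by simp)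
  exact (InnerProductSpace.toDual ℝ _).symm.toContinuousLinearEquiv.differentiable.comp h1

theorem weightedVol_pos {P : Set (EuclideanSpace ℝ (Fin n))} (hPc : IsCompact P)
    (hPint : (interior P).Nonempty) (V : EuclideanSpace ℝ (Fin n)) : 0 < weightedVol P V := by
  refine setIntegral_pos_iff_support_of_nonneg_ae
    (Filter.Eventually.of_forall fun p => (Real.exp_pos _).le)
    (Continuous.continuousOn (by fun_prop) |>.integrableOn_compact hPc) |>.2 ?_
  have : Function.support (fun p : EuclideanSpace ℝ (Fin n) => Real.exp ⟪V, p⟫) = Set.univ :=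
    Set.eq_univ_of_forall fun p => (Real.exp_pos _).ne'
  rw [this, Set.univ_inter]
  exact (isOpen_interior.measure_pos _ hPint).trans_le (measure_mono interior_subset)

/-- The gradient map transports `e^{-w} dx` to the weighted probability measure on `P`. -/
theorem setIntegral_exp_neg_preimage_gradient {P : Set (EuclideanSpace ℝ (Fin n))}
    (hPc : IsCompact P) (hP : Convex ℝ P) (hPint : (interior P).Nonempty)
    (V : EuclideanSpace ℝ (Fin n)) {f w : EuclideanSpace ℝ (Fin n) → ℝ}
    (hf : ContDiff ℝ (⊤ : ℕ∞) f) (hconv : StrictConvexOn ℝ Set.univ f)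
    (hrange : closure (Set.range (gradient f)) = P)
    (heq : ∀ x, Real.exp ⟪V, gradient f x⟫ / weightedVol P V * hessDet f x = Real.exp (-w x))
    {B : Set (EuclideanSpace ℝ (Fin n))} (hB : MeasurableSet B) :
    ∫ x in gradient f ⁻¹' B, Real.exp (-w x) = weightedVol (B ∩ P) V / weightedVol P V := by
  have hVol := weightedVol_pos hPc hPint V
  have hd : Differentiable ℝ f := hf.differentiable (by simp)
  have hg := differentiable_gradient_of_contDiff hf
  have hrangeP : (Set.range (gradient f) : Set _) =ᵐ[volume] P := by
    refine Filter.EventuallyLE.antisymm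
      (LE.le.eventuallyLE (hrange ▸ subset_closure)) ?_
    have h1 : interior P ⊆ Set.range (gradient f) := by
      conv_lhs => rw [← hrange]
      exact hconv.convexOn.interior_closure_range_gradient_subset hd
    have h2 : P =ᵐ[volume] interior P :=
      (interior_ae_eq_of_null_frontier (hP.addHaar_frontier _)).symm
    exact h2.le.trans (LE.le.eventuallyLE h1)
  have himage : gradient f '' (gradient f ⁻¹' B) = B ∩ Set.range (gradient f) :=
    Set.image_preimage_eq_inter_range
  have hcv := integral_image_eq_integral_abs_det_fderiv_smul volume
    (hg.continuous.measurable hB) (fun x _ => (hg x).hasFDerivAt.hasFDerivWithinAt)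
    (hconv.gradient_injective hd).injOn (fun p => Real.exp ⟪V, p⟫)
  rw [himage, setIntegral_congr_set ((Filter.EventuallyEq.refl _ B).inter hrangeP)] at hcv
  rw [weightedVol, hcv, ← integral_div]
  refine integral_congr_ae (Filter.Eventually.of_forall fun x => ?_)
  have hdet : (fderiv ℝ (gradient f) x).det = hessDet f x := rfl
  have hpos : 0 < hessDet f x := by
    have h1 := heq x ▸ Real.exp_pos (-w x)
    exact (mul_pos_iff_of_pos_left (by positivity)).1 h1
  simp only [hdet, abs_of_pos hpos, smul_eq_mul]
  rw [← heq x]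
  ring

end Transport

section Integration

variable {E : Type*} [NormedAddCommGroup E] [InnerProductSpace ℝ E] [FiniteDimensional ℝ E]
  [MeasurableSpace E] [BorelSpace E]

theorem one_add_pow_mul_exp_neg_le {c : ℝ} (hc : 0 < c) (m : ℕ) {s : ℝ} (hs : 0 ≤ s) :
    (1 + s) ^ m * Real.exp (-(c * s)) ≤ m.factorial * Real.exp c / c ^ m := by
  have h1 := Real.pow_div_factorial_le_exp (c * (1 + s)) (by positivity) m
  rw [div_le_iff₀ (by positivity), mul_pow] at h1
  rw [le_div_iff₀ (by positivity)]
  calc (1 + s) ^ m * Real.exp (-(c * s)) * c ^ m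
      = (c ^ m * (1 + s) ^ m) * Real.exp (-(c * s)) := by ring
    _ ≤ (Real.exp (c * (1 + s)) * m.factorial) * Real.exp (-(c * s)) := by gcongr
    _ = m.factorial * (Real.exp (c * (1 + s)) * Real.exp (-(c * s))) := by ring
    _ = m.factorial * Real.exp c := by rw [← Real.exp_add]; ring_nf

theorem integrable_one_add_norm_mul_exp_neg {w : E → ℝ} (hw : Continuous w) {c C : ℝ}
    (hc : 0 < c) (hlow : ∀ x, c * ‖x‖ - C ≤ w x) :
    Integrable (fun x => (1 + ‖x‖) * Real.exp (-w x)) := by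
  set d := Module.finrank ℝ E
  have hJ : Integrable (fun x : E => (1 + ‖x‖) ^ (-((d + 1 : ℕ) : ℝ))) :=
    integrable_one_add_norm (by push_cast; linarith)
  refine (hJ.const_mul (Real.exp C * ((d + 2).factorial * Real.exp c / c ^ (d + 2)))).mono'
    (by fun_prop) (Filter.Eventually.of_forall fun x => ?_)
  rw [Real.norm_of_nonneg (by positivity), Real.rpow_neg (by positivity), Real.rpow_natCast,
    ← div_eq_mul_inv, le_div_iff₀ (by positivity)]
  calc (1 + ‖x‖) * Real.exp (-w x) * (1 + ‖x‖) ^ (d + 1)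
      = (1 + ‖x‖) ^ (d + 2) * Real.exp (-w x) := by ring
    _ ≤ (1 + ‖x‖) ^ (d + 2) * Real.exp (C + -(c * ‖x‖)) := by
        gcongr
        linarith [hlow x]
    _ = Real.exp C * ((1 + ‖x‖) ^ (d + 2) * Real.exp (-(c * ‖x‖))) := by
        rw [Real.exp_add]; ring
    _ ≤ _ := by
        gcongr
        exact one_add_pow_mul_exp_neg_le hc _ (norm_nonneg x)

theorem integral_inner_gradient_mul_exp_neg {w : E → ℝ} {g : E → E}
    (hw : ∀ x, HasGradientAt w (g x) x) (hg : Continuous g) {R : ℝ} (hR : ∀ x, ‖g x‖ ≤ R)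
    (hint : Integrable (fun x => (1 + ‖x‖) * Real.exp (-w x))) (b : E) :
    ∫ x, Real.exp (-w x) * ⟪g x, x - b⟫ = Module.finrank ℝ E * ∫ x, Real.exp (-w x) := by
  have hwc : Continuous w := continuous_iff_continuousAt.2 fun x => (hw x).continuousAt
  have hR0 : 0 ≤ R := (norm_nonneg _).trans (hR 0)
  have hdom : ∀ φ : E → ℝ, Continuous φ → (∃ K, ∀ x, |φ x| ≤ K * (1 + ‖x‖)) →
      Integrable (fun x => φ x * Real.exp (-w x)) := by
    rintro φ hφ ⟨K, hK⟩
    refine (hint.const_mul K).mono' (by fun_prop) (Filter.Eventually.of_forall fun x => ?_)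
    rw [norm_mul, Real.norm_eq_abs, Real.norm_of_nonneg (Real.exp_pos _).le, ← mul_assoc]
    gcongr
    exact hK x
  have hlin : ∀ x, ‖x - b‖ ≤ (1 + ‖b‖) * (1 + ‖x‖) := fun x => by
    nlinarith [norm_sub_le x b, norm_nonneg x, norm_nonneg b, mul_nonneg (norm_nonneg x) (norm_nonneg b)]
  let e := stdOrthonormalBasis ℝ E
  have hexp : ∀ x, HasFDerivAt (fun x => Real.exp (-w x))
      (Real.exp (-w x) • -(innerSL ℝ (g x))) x := fun x => (hw x).hasFDerivAt.neg.exp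
  have hlinD : ∀ (i) (x : E), HasFDerivAt (fun x => ⟪e i, x - b⟫) (innerSL ℝ (e i)) x := fun i x =>
    (innerSL ℝ (e i)).hasFDerivAt.comp x ((hasFDerivAt_id x).sub_const b)
  have hI1 : ∀ i, Integrable (fun x => ⟪e i, x - b⟫ * Real.exp (-w x)) := fun i => by
    refine hdom _ (by fun_prop) ⟨1 + ‖b‖, fun x => ?_⟩
    refine (abs_real_inner_le_norm _ _).trans ?_
    rw [e.norm_eq_one, one_mul]
    exact hlin x
  have hI2 : ∀ i, Integrable (fun x => ⟪e i, x - b⟫ * (Real.exp (-w x) * ⟪g x, e i⟫)) := fun i => by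
    have := hdom (fun x => ⟪e i, x - b⟫ * ⟪g x, e i⟫) (by fun_prop)
      ⟨(1 + ‖b‖) * R, fun x => ?_⟩
    · refine this.congr (Filter.Eventually.of_forall fun x => ?_)
      simp only
      ring
    · rw [abs_mul, mul_right_comm]
      refine mul_le_mul ((abs_real_inner_le_norm _ _).trans ?_)
        ((abs_real_inner_le_norm _ _).trans ?_) (abs_nonneg _) (by positivity)
      · rw [e.norm_eq_one, one_mul]
        exact hlin x
      · rw [e.norm_eq_one, mul_one]
        exact hR x
  have hI3 : Integrable (fun x => Real.exp (-w x)) := by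
    simpa using hdom (fun _ => 1) continuous_const
      ⟨1, fun x => by simp⟩
  have key : ∀ i, ∫ x, ⟪e i, x - b⟫ * (Real.exp (-w x) * ⟪g x, e i⟫) =
      ∫ x, Real.exp (-w x) := fun i => by
    have := integral_mul_fderiv_eq_neg_fderiv_mul_of_integrable (μ := (volume : Measure E))
      (f := fun x => ⟪e i, x - b⟫)
      (g := fun x => Real.exp (-w x)) (v := e i)
      (by simpa [(hlinD i _).fderiv] using hI3)
      (by simpa [(hexp _).fderiv] using (hI2 i).neg) (hI1 i)
      (fun x _ => (hlinD i x).differentiableAt) (fun x _ => (hexp x).differentiableAt)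
    simpa [(hlinD i _).fderiv, (hexp _).fderiv, integral_neg] using this
  have hsum : ∀ x, Real.exp (-w x) * ⟪g x, x - b⟫ =
      ∑ i, ⟪e i, x - b⟫ * (Real.exp (-w x) * ⟪g x, e i⟫) := fun x => by
    rw [← e.sum_inner_mul_inner, Finset.mul_sum]
    exact Finset.sum_congr rfl fun i _ => by ring
  simp_rw [hsum]
  rw [integral_finsetSum _ fun i _ => hI2 i, Finset.sum_congr rfl fun i _ => key i]
  simp

theorem integrable_inner_sub_of_bounded {μ : Measure E} [IsFiniteMeasure μ]
    (hμ : Integrable (fun x : E => ‖x‖) μ) {g : E → E} (hg : Continuous g) {R : ℝ}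
    (hR : ∀ x, ‖g x‖ ≤ R) (b : E) : Integrable (fun x => ⟪g x, x - b⟫) μ := by
  refine ((hμ.add (integrable_const ‖b‖)).const_mul R).mono' (by fun_prop)
    (Filter.Eventually.of_forall fun x => ?_)
  refine (norm_inner_le_norm _ _).trans ?_
  exact mul_le_mul (hR x) (norm_sub_le _ _) (norm_nonneg _) ((norm_nonneg _).trans (hR x))

theorem integral_inner_sub_mean_eq_zero {μ : Measure E} [IsProbabilityMeasure μ]
    (hμ : Integrable (fun x : E => ‖x‖) μ) (q : E) : ∫ x, ⟪q, x - ∫ y, y ∂μ⟫ ∂μ = 0 := by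
  have hid : Integrable (fun x : E => x) μ := (integrable_norm_iff (by fun_prop)).1 hμ
  have hsub : Integrable (fun x : E => x - ∫ y, y ∂μ) μ := hid.sub (integrable_const _)
  rw [integral_inner hsub, integral_sub hid (integrable_const _)]
  simp

/-- The correlation of a monotone map with the centred identity is nonnegative. -/
theorem integral_inner_sub_mean_nonneg {μ : Measure E} [IsProbabilityMeasure μ]
    (hμ : Integrable (fun x : E => ‖x‖) μ) {g : E → E} (hg : Continuous g) {R : ℝ}
    (hR : ∀ x, ‖g x‖ ≤ R) (hmono : ∀ x y, 0 ≤ ⟪g x - g y, x - y⟫) :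
    0 ≤ ∫ x, ⟪g x, x - ∫ y, y ∂μ⟫ ∂μ := by
  set b := ∫ y, y ∂μ with hb
  rw [← integral_inner_sub_mean_eq_zero hμ (g b), ← hb]
  refine integral_mono (integrable_inner_sub_of_bounded hμ continuous_const (fun _ => hR b) b)
    (integrable_inner_sub_of_bounded hμ hg hR b) fun x => ?_
  have := hmono x b
  rw [inner_sub_left] at this
  simp only
  linarith

/-- Quantitative form of the monotonicity of a subgradient map: if the push-forward of `μ` charges
enough well-spread balls, its correlation with the centred identity controls the first moment. -/
theorem mul_integral_norm_sub_mean_le {μ : Measure E} [IsProbabilityMeasure μ]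
    (hμ : Integrable (fun x : E => ‖x‖) μ) {f : E → ℝ} (hf : Continuous f) {g : E → E}
    (hg : Continuous g) {R : ℝ} (hR : ∀ x, ‖g x‖ ≤ R)
    (hsub : ∀ z x, f z + ⟪g z, x - z⟫ ≤ f x) {p : E} {c ε ν : ℝ} (hc : 0 ≤ c) {T : Finset E}
    (hT : ∀ q : E → E, (∀ y ∈ T, dist (q y) y ≤ ε) →
      ∀ v : E, ∃ y ∈ T, ⟪p, v⟫ + c * ‖v‖ ≤ ⟪q y, v⟫)
    (hν : ∀ y ∈ T, ν ≤ μ.real (g ⁻¹' Metric.closedBall y ε)) :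
    ν / (T.card + 1) * c * ∫ x, ‖x - ∫ y, y ∂μ‖ ∂μ ≤ ∫ x, ⟪g x, x - ∫ y, y ∂μ⟫ ∂μ := by
  set b := ∫ y, y ∂μ with hb
  have hid : Integrable (fun x : E => x) μ := (integrable_norm_iff (by fun_prop)).1 hμ
  have hR0 : 0 ≤ R := (norm_nonneg _).trans (hR 0)
  have hfi : Integrable f μ := by
    refine ((hμ.const_mul R).add (integrable_const |f 0|)).mono' (by fun_prop)
      (Filter.Eventually.of_forall fun x => ?_)
    have h1 := hsub 0 x
    have h2 := hsub x 0
    have h3 := (abs_real_inner_le_norm (g 0) (x - 0)).trans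
      (mul_le_mul_of_nonneg_right (hR 0) (norm_nonneg _))
    have h4 := (abs_real_inner_le_norm (g x) (0 - x)).trans
      (mul_le_mul_of_nonneg_right (hR x) (norm_nonneg _))
    rw [sub_zero] at h1 h3
    rw [zero_sub, norm_neg] at h4
    rw [zero_sub] at h2
    have h5 := abs_le.1 h3
    have h6 := abs_le.1 h4
    have h7 := neg_abs_le (f 0)
    have h8 := le_abs_self (f 0)
    rw [Real.norm_eq_abs, abs_le, Pi.add_apply]
    constructor <;> linarith
  have hgi := integrable_inner_sub_of_bounded hμ hg hR b
  have hmean : ∀ q : E, ∫ x, ⟪q, x - b⟫ ∂μ = 0 :=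
    integral_inner_sub_mean_eq_zero hμ
  have hci : ∀ q : E, Integrable (fun x => ⟪q, x - b⟫) μ := fun q =>
    integrable_inner_sub_of_bounded hμ continuous_const (fun _ => le_rfl) b
  have hni : Integrable (fun x => ‖x - b‖) μ := (hid.sub (integrable_const b)).norm
  set A := ∫ x, f x ∂μ with hA
  set D := c * ∫ x, ‖x - b‖ ∂μ with hD
  have hD0 : 0 ≤ D := mul_nonneg hc (integral_nonneg fun _ => norm_nonneg _)
  set G : E → ℝ := fun z => ⟪g z, z - b⟫ - f z + A with hGdef
  have hgf : Integrable (fun z => ⟪g z, z - b⟫ - f z) μ := hgi.sub hfi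
  have hGi : Integrable G μ := hgf.add (integrable_const A)
  have hGint : ∫ z, G z ∂μ = ∫ x, ⟪g x, x - b⟫ ∂μ := by
    simp only [hGdef]
    rw [integral_add hgf (integrable_const A), integral_sub hgi hfi]
    simp [hA]
  have hGx : ∀ z x, ⟪g z, x - b⟫ - f x + A ≤ G z := fun z x => by
    have := hsub z x
    have h2 : ⟪g z, x - b⟫ = ⟪g z, x - z⟫ + ⟪g z, z - b⟫ := by
      rw [← inner_add_right, sub_add_sub_cancel]
    simp only [hGdef]
    linarith
  have hG0 : ∀ z, 0 ≤ G z := fun z => by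
    have hzf : Integrable (fun x => ⟪g z, x - b⟫ - f x) μ := (hci (g z)).sub hfi
    have hzA : Integrable (fun x => ⟪g z, x - b⟫ - f x + A) μ := hzf.add (integrable_const A)
    have := integral_mono hzA (integrable_const (G z)) (hGx z)
    rw [integral_add hzf (integrable_const A), integral_sub (hci (g z)) hfi, hmean] at this
    simpa [← hA] using this
  rw [← hGint, mul_assoc, ← hD]
  rcases hD0.eq_or_lt with hD0 | hDpos
  · rw [← hD0, mul_zero]
    exact integral_nonneg hG0
  obtain ⟨y, hy, hyG⟩ : ∃ y ∈ T, ∀ z ∈ g ⁻¹' Metric.closedBall y ε, D / (T.card + 1) ≤ G z := by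
    by_contra! hcon
    have hz : ∀ y : E, ∃ z, y ∈ T → dist (g z) y ≤ ε ∧ G z < D / (T.card + 1) := fun y => by
      by_cases hy : y ∈ T
      · obtain ⟨z, hz⟩ := hcon y hy
        exact ⟨z, fun _ => hz⟩
      · exact ⟨0, fun h => absurd h hy⟩
    choose z hz using hz
    have hpt : ∀ x, c * ‖x - b‖ + (⟪p, x - b⟫ - f x + A) ≤ ∑ y ∈ T, G (z y) := fun x => by
      obtain ⟨y, hy, hyx⟩ := hT (fun y => g (z y)) (fun y hy => (hz y hy).1) (x - b)
      have h1 := hGx (z y) x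
      have h2 := Finset.single_le_sum (f := fun y => G (z y)) (fun i _ => hG0 _) hy
      linarith
    have hpf : Integrable (fun x => ⟪p, x - b⟫ - f x) μ := (hci p).sub hfi
    have hpA : Integrable (fun x => ⟪p, x - b⟫ - f x + A) μ := hpf.add (integrable_const A)
    have hpn : Integrable (fun x => c * ‖x - b‖ + (⟪p, x - b⟫ - f x + A)) μ :=
      (hni.const_mul c).add hpA
    have h1 := integral_mono hpn (integrable_const (∑ y ∈ T, G (z y))) hpt
    rw [integral_add (hni.const_mul c) hpA, integral_add hpf (integrable_const A),
      integral_sub (hci p) hfi, hmean, integral_const_mul] at h1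
    simp only [← hA, ← hD, integral_const, probReal_univ, one_smul] at h1
    have h2 := Finset.sum_le_card_nsmul T (fun y => G (z y)) _ fun y hy => (hz y hy).2.le
    rw [nsmul_eq_mul] at h2
    have h3 : (T.card : ℝ) * (D / (T.card + 1)) < D := by
      rw [mul_div_assoc', div_lt_iff₀ (by positivity)]
      linarith
    linarith
  have hmeas : MeasurableSet (g ⁻¹' Metric.closedBall y ε) :=
    (Metric.isClosed_closedBall.preimage hg).measurableSet
  calc ν / (T.card + 1) * D = ν * (D / (T.card + 1)) := by ring
    _ ≤ μ.real (g ⁻¹' Metric.closedBall y ε) * (D / (T.card + 1)) := by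
        gcongr
        exact hν y hy
    _ = ∫ _ in g ⁻¹' Metric.closedBall y ε, D / (T.card + 1) ∂μ := by simp
    _ ≤ ∫ z in g ⁻¹' Metric.closedBall y ε, G z ∂μ :=
        setIntegral_mono_on (by simp) hGi.integrableOn hmeas hyG
    _ ≤ ∫ z, G z ∂μ := setIntegral_le_integral hGi (Filter.Eventually.of_forall hG0)

end Integration

section LogSumExp

variable {E : Type*} [NormedAddCommGroup E] [InnerProductSpace ℝ E]

/-- The gradient of `x ↦ log (N⁻¹ ∑_{y ∈ S} e^{⟨y,x⟩})`. -/
noncomputable def logSumExpGrad (S : Finset E) (x : E) : E :=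
  ∑ y ∈ S, (Real.exp ⟪y, x⟫ / ∑ z ∈ S, Real.exp ⟪z, x⟫) • y

theorem sum_exp_inner_pos {S : Finset E} (hS : S.Nonempty) (x : E) :
    0 < ∑ y ∈ S, Real.exp ⟪y, x⟫ :=
  Finset.sum_pos (fun _ _ => Real.exp_pos _) hS

theorem continuous_logSumExpGrad {S : Finset E} (hS : S.Nonempty) :
    Continuous (logSumExpGrad S) := by
  unfold logSumExpGrad
  have := fun x => (sum_exp_inner_pos hS x).ne'
  fun_prop (disch := assumption)

theorem norm_logSumExpGrad_le {S : Finset E} (hS : S.Nonempty) {R : ℝ} (hR : ∀ y ∈ S, ‖y‖ ≤ R)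
    (x : E) : ‖logSumExpGrad S x‖ ≤ R := by
  have hZ := sum_exp_inner_pos hS x
  calc ‖logSumExpGrad S x‖
      ≤ ∑ y ∈ S, (Real.exp ⟪y, x⟫ / ∑ z ∈ S, Real.exp ⟪z, x⟫) * R := by
        refine norm_sum_le_of_le _ fun y hy => ?_
        rw [norm_smul, Real.norm_of_nonneg (by positivity)]
        gcongr
        exact hR y hy
    _ = R := by rw [← Finset.sum_mul, ← Finset.sum_div, div_self hZ.ne', one_mul]

theorem hasGradientAt_logSumExp [CompleteSpace E] {S : Finset E} (hS : S.Nonempty) (x : E) :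
    HasGradientAt (fun x => Real.log ((S.card : ℝ)⁻¹ * ∑ y ∈ S, Real.exp ⟪y, x⟫))
      (logSumExpGrad S x) x := by
  have hZ := sum_exp_inner_pos hS x
  have hN : (0 : ℝ) < S.card := by exact_mod_cast hS.card_pos
  have h1 : HasFDerivAt (fun x => ∑ y ∈ S, Real.exp ⟪y, x⟫)
      (∑ y ∈ S, Real.exp ⟪y, x⟫ • innerSL ℝ y) x :=
    HasFDerivAt.fun_sum fun y _ => ((innerSL ℝ y).hasFDerivAt (x := x)).exp
  have h2 := (h1.const_mul ((S.card : ℝ)⁻¹)).log (by positivity)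
  rw [hasGradientAt_iff_hasFDerivAt]
  refine h2.congr_fderiv ?_
  ext v
  simp only [logSumExpGrad, smul_smul, map_sum, map_smul, smul_apply,
    sum_apply, innerSL_apply_apply, smul_eq_mul, Finset.mul_sum,
    InnerProductSpace.toDual_apply_apply]
  refine Finset.sum_congr rfl fun y _ => ?_
  rw [← Finset.mul_sum]
  field_simp

theorem logSumExp_add_inner_le {S : Finset E} (hS : S.Nonempty) (z x : E) :
    Real.log ((S.card : ℝ)⁻¹ * ∑ y ∈ S, Real.exp ⟪y, z⟫) + ⟪logSumExpGrad S z, x - z⟫ ≤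
      Real.log ((S.card : ℝ)⁻¹ * ∑ y ∈ S, Real.exp ⟪y, x⟫) := by
  have hZ := sum_exp_inner_pos hS z
  have hX := sum_exp_inner_pos hS x
  have hN : (0 : ℝ) < S.card := by exact_mod_cast hS.card_pos
  have hJ := convexOn_exp.map_sum_le (t := S)
    (w := fun y => Real.exp ⟪y, z⟫ / ∑ u ∈ S, Real.exp ⟪u, z⟫) (p := fun y => ⟪y, x - z⟫)
    (fun _ _ => by positivity) (by rw [← Finset.sum_div, div_self hZ.ne']) (by simp)
  have h1 : ∑ y ∈ S, (Real.exp ⟪y, z⟫ / ∑ u ∈ S, Real.exp ⟪u, z⟫) • ⟪y, x - z⟫ =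
      ⟪logSumExpGrad S z, x - z⟫ := by
    simp [logSumExpGrad, sum_inner, real_inner_smul_left]
  have h2 : ∑ y ∈ S, (Real.exp ⟪y, z⟫ / ∑ u ∈ S, Real.exp ⟪u, z⟫) • Real.exp ⟪y, x - z⟫ =
      (∑ y ∈ S, Real.exp ⟪y, x⟫) / ∑ u ∈ S, Real.exp ⟪u, z⟫ := by
    rw [Finset.sum_div]
    refine Finset.sum_congr rfl fun y _ => ?_
    rw [smul_eq_mul, div_mul_eq_mul_div, ← Real.exp_add, ← inner_add_right, add_sub_cancel]
  rw [h1, h2, ← Real.le_log_iff_exp_le (by positivity), Real.log_div hX.ne' hZ.ne'] at hJ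
  rw [Real.log_mul (by positivity) hZ.ne', Real.log_mul (by positivity) hX.ne']
  linarith

theorem inner_sub_log_card_le_logSumExp {P : Set E} (hPc : IsCompact P) (hP : Convex ℝ P)
    {S : Finset E} (hSP : (S : Set E) = Set.extremePoints ℝ P) (hS : S.Nonempty) {q : E}
    (hq : q ∈ P) (x : E) :
    ⟪q, x⟫ - Real.log S.card ≤ Real.log ((S.card : ℝ)⁻¹ * ∑ y ∈ S, Real.exp ⟪y, x⟫) := by
  have hX := sum_exp_inner_pos hS x
  have hN : (0 : ℝ) < S.card := by exact_mod_cast hS.card_pos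
  rw [Real.log_mul (by positivity) hX.ne', Real.log_inv]
  have hsub : P ⊆ {q : E | ⟪q, x⟫ ≤ Real.log (∑ y ∈ S, Real.exp ⟪y, x⟫)} := by
    rw [← closure_convexHull_extremePoints hPc hP, ← hSP]
    refine closure_minimal (convexHull_min (fun y hy => ?_) ?_)
      (isClosed_le (by fun_prop) continuous_const)
    · rw [Set.mem_ofPred_eq, Real.le_log_iff_exp_le hX]
      exact Finset.single_le_sum (f := fun y => Real.exp ⟪y, x⟫) (fun _ _ => (Real.exp_pos _).le) hy
    · exact convex_halfSpace_le ⟨fun _ _ => inner_add_left _ _ _,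
        fun _ _ => real_inner_smul_left _ _ _⟩ _
  have : ⟪q, x⟫ ≤ _ := hsub hq
  linarith

end LogSumExp

section Bounds

variable {E : Type*} [NormedAddCommGroup E] [InnerProductSpace ℝ E] [FiniteDimensional ℝ E]

theorem exists_mul_norm_sub_le_sum {ι : Type*} [Fintype ι] {P D : ι → Set E}
    (hzero : (0 : E) ∈ interior (∑ i, P i)) (hPD : ∀ i, P i ⊆ closure (D i)) {u : ι → E → ℝ}
    (hu : ∀ i, ∀ q ∈ D i, ∃ K : ℝ, ∀ x, ⟪q, x⟫ - K ≤ u i x) :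
    ∃ c > 0, ∃ C : ℝ, ∀ x, c * ‖x‖ - C ≤ ∑ i, u i x := by
  obtain ⟨r, hr, hball⟩ := Metric.nhds_basis_closedBall.mem_iff.1
    (mem_interior_iff_mem_nhds.1 hzero)
  obtain ⟨T, hT, hTq⟩ := exists_finset_inner_ge (0 : E) hr
  set δ := r / (4 * (Fintype.card ι + 1)) with hδ
  have hδ0 : 0 < δ := by positivity
  have hex : ∀ y : E, ∃ q : E, ∃ K : ℝ, 0 ≤ K ∧
      (y ∈ T → dist q y ≤ r / 4 ∧ ∀ x, ⟪q, x⟫ - K ≤ ∑ i, u i x) := by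
    intro y
    by_cases hy : y ∈ T
    swap
    · exact ⟨0, 0, le_rfl, fun h => absurd h hy⟩
    obtain ⟨s, hs, hsy⟩ := (Set.mem_fintype_sum _ _).1 (hball (hT y hy))
    have hq : ∀ i, ∃ q ∈ D i, dist (s i) q < δ := fun i =>
      Metric.mem_closure_iff.1 (hPD i (hs i)) δ hδ0
    choose q hqD hqs using hq
    choose K hK using fun i => hu i (q i) (hqD i)
    refine ⟨∑ i, q i, |∑ i, K i|, abs_nonneg _, fun _ => ⟨?_, fun x => ?_⟩⟩
    · rw [← hsy, dist_comm]
      refine (dist_sum_sum_le_of_le _ fun i _ => (hqs i).le).trans ?_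
      rw [Finset.sum_const, nsmul_eq_mul, Finset.card_univ, hδ, mul_div_assoc',
        div_le_div_iff₀ (by positivity) (by positivity)]
      nlinarith
    · have h1 := Finset.sum_le_sum fun i (_ : i ∈ Finset.univ) => hK i x
      rw [Finset.sum_sub_distrib, ← sum_inner] at h1
      linarith [le_abs_self (∑ i, K i)]
  choose q K hK0 hq using hex
  refine ⟨r / 2, by positivity, ∑ y ∈ T, K y, fun x => ?_⟩
  obtain ⟨y, hy, hyx⟩ := hTq q (fun y hy => (hq y hy).1) x
  have h1 := (hq y hy).2 x
  have h2 := Finset.single_le_sum (f := K) (fun i _ => hK0 i) hy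
  rw [inner_zero_left] at hyx
  linarith

variable [MeasurableSpace E] [BorelSpace E]

theorem integral_exp_neg_mul_norm_pos {R : ℝ} (hR : 0 < R) :
    0 < ∫ x : E, Real.exp (-(R * ‖x‖)) := by
  have hint := integrable_one_add_norm_mul_exp_neg (E := E) (w := fun x => R * ‖x‖)
    (by fun_prop) hR (C := 0) (fun x => by simp)
  refine integral_exp_pos (hint.mono' (by fun_prop) (Filter.Eventually.of_forall fun x => ?_))
  rw [Real.norm_of_nonneg (Real.exp_pos _).le]
  exact le_mul_of_one_le_left (Real.exp_pos _).le (by linarith [norm_nonneg x])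

theorem log_integral_le_of_lipschitz {w : E → ℝ} {R : ℝ} (hR : 0 < R)
    (hw : ∀ z x, w x ≤ w z + R * ‖x - z‖) (hint : Integrable fun x => Real.exp (-w x))
    (hone : ∫ x, Real.exp (-w x) = 1) (z : E) :
    Real.log (∫ x : E, Real.exp (-(R * ‖x‖))) ≤ w z := by
  rw [Real.log_le_iff_le_exp (integral_exp_neg_mul_norm_pos hR)]
  have h1 : ∫ x, Real.exp (-w z) * Real.exp (-(R * ‖x - z‖)) ≤ ∫ x, Real.exp (-w x) := by
    refine integral_mono_of_nonneg (Filter.Eventually.of_forall fun x => by positivity) hint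
      (Filter.Eventually.of_forall fun x => ?_)
    simp only
    rw [← Real.exp_add, Real.exp_le_exp]
    linarith [hw z x]
  rw [integral_const_mul, integral_sub_right_eq_self (fun x : E => Real.exp (-(R * ‖x‖))),
    hone, Real.exp_neg, inv_mul_le_iff₀ (Real.exp_pos _), mul_one] at h1
  exact h1

theorem exists_le_log_of_integral_norm_sub_le {w : E → ℝ}
    (hint : Integrable fun x => Real.exp (-w x)) (hone : ∫ x, Real.exp (-w x) = 1) {b : E} {D : ℝ}
    (hD : 0 < D) (hintb : Integrable fun x => Real.exp (-w x) * ‖x - b‖)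
    (hb : ∫ x, Real.exp (-w x) * ‖x - b‖ ≤ D) :
    ∃ x, w x ≤ Real.log (2 * volume.real (Metric.closedBall (0 : E) (3 * D))) := by
  by_contra! hcon
  set v := volume.real (Metric.closedBall (0 : E) (3 * D)) with hv
  have hvb : volume.real (Metric.closedBall b (3 * D)) = v := by
    rw [hv, measureReal_def, measureReal_def, Measure.addHaar_closedBall_center]
  have hv0 : 0 < v :=
    ENNReal.toReal_pos (Metric.measure_closedBall_pos _ _ (by positivity)).ne'
      measure_closedBall_lt_top.ne
  have hI : Integrable ((Metric.closedBall b (3 * D)).indicator fun _ : E => (2 * v)⁻¹) :=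
    (integrable_indicator_iff Metric.isClosed_closedBall.measurableSet).2
      (integrableOn_const measure_closedBall_lt_top.ne)
  have hpt : ∀ x, Real.exp (-w x) ≤ (Metric.closedBall b (3 * D)).indicator (fun _ => (2 * v)⁻¹) x
      + (3 * D)⁻¹ * (Real.exp (-w x) * ‖x - b‖) := by
    intro x
    by_cases hx : x ∈ Metric.closedBall b (3 * D)
    · rw [Set.indicator_of_mem hx]
      have h1 : Real.exp (-w x) ≤ (2 * v)⁻¹ := by
        rw [← Real.exp_log (show 0 < (2 * v)⁻¹ by positivity), Real.log_inv, Real.exp_le_exp]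
        linarith [hcon x]
      have : 0 ≤ (3 * D)⁻¹ * (Real.exp (-w x) * ‖x - b‖) := by positivity
      linarith
    · rw [Set.indicator_of_notMem hx, zero_add, inv_mul_eq_div, le_div_iff₀ (by positivity)]
      rw [Metric.mem_closedBall, dist_eq_norm, not_le] at hx
      gcongr
  have h1 := integral_mono hint (hI.add (hintb.const_mul _)) hpt
  simp only [Pi.add_apply] at h1
  rw [integral_add hI (hintb.const_mul _), integral_const_mul, hone,
    integral_indicator Metric.isClosed_closedBall.measurableSet, setIntegral_const, hvb] at h1
  have h2 : v • (2 * v)⁻¹ = (1 / 2 : ℝ) := by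
    rw [smul_eq_mul]; field_simp
  have h3 : (3 * D)⁻¹ * ∫ x, Real.exp (-w x) * ‖x - b‖ ≤ 1 / 3 := by
    rw [inv_mul_le_iff₀ (by positivity)]
    linarith
  linarith

end Bounds

section Density

variable {E : Type*} [MeasureSpace E] {w : E → ℝ}

theorem integral_withDensity_exp_neg (hw : Measurable w) (φ : E → ℝ) :
    ∫ x, φ x ∂(volume.withDensity fun x => ENNReal.ofReal (Real.exp (-w x))) =
      ∫ x, Real.exp (-w x) * φ x := by
  rw [integral_withDensity_eq_integral_toReal_smul (by fun_prop)
    (Filter.Eventually.of_forall fun _ => ENNReal.ofReal_lt_top)]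
  simp [ENNReal.toReal_ofReal, Real.exp_nonneg]

theorem integrable_withDensity_exp_neg_iff (hw : Measurable w) (φ : E → ℝ) :
    Integrable φ (volume.withDensity fun x => ENNReal.ofReal (Real.exp (-w x))) ↔
      Integrable fun x => Real.exp (-w x) * φ x := by
  rw [integrable_withDensity_iff_integrable_smul' (by fun_prop)
    (Filter.Eventually.of_forall fun _ => ENNReal.ofReal_lt_top)]
  simp [ENNReal.toReal_ofReal, Real.exp_nonneg]

theorem withDensity_exp_neg_real_apply (hint : Integrable fun x => Real.exp (-w x)) {A : Set E}
    (hA : MeasurableSet A) :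
    (volume.withDensity fun x => ENNReal.ofReal (Real.exp (-w x))).real A =
      ∫ x in A, Real.exp (-w x) := by
  rw [measureReal_def, withDensity_apply _ hA, ← ofReal_integral_eq_lintegral_ofReal
    hint.integrableOn (Filter.Eventually.of_forall fun _ => (Real.exp_pos _).le),
    ENNReal.toReal_ofReal (integral_nonneg fun _ => (Real.exp_pos _).le)]

theorem isProbabilityMeasure_withDensity_exp_neg (hint : Integrable fun x => Real.exp (-w x))
    (hone : ∫ x, Real.exp (-w x) = 1) :
    IsProbabilityMeasure (volume.withDensity fun x => ENNReal.ofReal (Real.exp (-w x))) := by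
  refine ⟨?_⟩
  rw [withDensity_apply _ MeasurableSet.univ, Measure.restrict_univ,
    ← ofReal_integral_eq_lintegral_ofReal hint
      (Filter.Eventually.of_forall fun _ => (Real.exp_pos _).le), hone, ENNReal.ofReal_one]

end Density

/-- Steps 1 and 2 of the proof of Lemma 5.1: the infimum
`m = inf ∑ᵢ (t fᵢ + (1−t) hᵢ)` is uniformly bounded along the continuity path. -/
theorem stmt9 {n k : ℕ}
    (P : Fin k → Set (EuclideanSpace ℝ (Fin n)))
    (hpoly : ∀ i, ∃ T : Finset (EuclideanSpace ℝ (Fin n)), P i = convexHull ℝ ↑T)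
    (hPint : ∀ i, (interior (P i)).Nonempty)
    (hzero : (0 : EuclideanSpace ℝ (Fin n)) ∈ interior (∑ i, P i))
    (V : Fin k → EuclideanSpace ℝ (Fin n))
    (hA : ∑ i, weightedBary (P i) (V i) = 0)
    (S : Fin k → Finset (EuclideanSpace ℝ (Fin n)))
    (hS : ∀ i, (S i : Set (EuclideanSpace ℝ (Fin n)))
      = Set.extremePoints ℝ (P i))
    (h : Fin k → EuclideanSpace ℝ (Fin n) → ℝ)
    (hh : ∀ i x, h i x
      = Real.log (((S i).card : ℝ)⁻¹ * ∑ y ∈ S i, Real.exp ⟪y, x⟫)) :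
    ∀ t₀ ∈ Set.Ioc (0 : ℝ) 1, ∃ C : ℝ,
      ∀ t ∈ Set.Icc t₀ 1, ∀ f : Fin k → EuclideanSpace ℝ (Fin n) → ℝ,
      (∀ i, ContDiff ℝ (⊤ : ℕ∞) (f i)) →
      (∀ i, StrictConvexOn ℝ Set.univ (f i)) →
      (∀ i, closure (Set.range (gradient (f i))) = P i) →
      (∀ i x, Real.exp ⟪V i, gradient (f i) x⟫ / weightedVol (P i) (V i)
          * hessDet (f i) x
        = Real.exp (-t * ∑ j, f j x - (1 - t) * ∑ j, h j x)) →
      |⨅ x : EuclideanSpace ℝ (Fin n), ∑ i, (t * f i x + (1 - t) * h i x)| ≤ C := by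
  rintro t₀ ⟨ht₀, -⟩
  rcases isEmpty_or_nonempty (Fin k) with hk | ⟨⟨i₀⟩⟩
  · exact ⟨0, by simp⟩
  have hPc : ∀ i, IsCompact (P i) := fun i => by
    obtain ⟨T, hT⟩ := hpoly i
    exact hT ▸ T.finite_toSet.isCompact_convexHull ℝ
  have hP : ∀ i, Convex ℝ (P i) := fun i => by
    obtain ⟨T, hT⟩ := hpoly i
    exact hT ▸ convex_convexHull ℝ _
  have hSne : ∀ i, (S i).Nonempty := fun i => by
    rw [← Finset.coe_nonempty, hS i]
    exact (hPc i).extremePoints_nonempty ((hPint i).mono interior_subset)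
  obtain ⟨R, hR⟩ : ∃ R : ℝ, ∀ i, ∀ p ∈ P i, ‖p‖ ≤ R := by
    obtain ⟨R, hR⟩ := (isCompact_iUnion hPc).isBounded.exists_norm_le
    exact ⟨R, fun i p hp => hR p (Set.mem_iUnion.2 ⟨i, hp⟩)⟩
  have hR0 : 0 ≤ R := by
    obtain ⟨p, hp⟩ := hPint i₀
    exact (norm_nonneg p).trans (hR i₀ p (interior_subset hp))
  set L : ℝ := k * R + 1 with hL
  have hL0 : 0 < L := by positivity
  -- finitely many balls in `P i₀` that detect the norm, and their least transported mass
  obtain ⟨p, hp⟩ := hPint i₀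
  obtain ⟨r', hr', hball⟩ := Metric.nhds_basis_closedBall.mem_iff.1
    (mem_interior_iff_mem_nhds.1 hp)
  obtain ⟨r, rfl⟩ : ∃ r, r' = 2 * r := ⟨r' / 2, by ring⟩
  have hr : 0 < r := by linarith
  obtain ⟨T, hTb, hTq⟩ := exists_finset_inner_ge p hr
  set F : EuclideanSpace ℝ (Fin n) → ℝ := fun y =>
    weightedVol (Metric.closedBall y (r / 4) ∩ P i₀) (V i₀) / weightedVol (P i₀) (V i₀) with hF
  have hF0 : ∀ y ∈ T, 0 < F y := fun y hy => by
    have hsub : Metric.closedBall y (r / 4) ⊆ P i₀ :=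
      (Metric.closedBall_subset_closedBall' (by
        have := Metric.mem_closedBall.1 (hTb y hy)
        linarith)).trans hball
    simp only [hF]
    rw [Set.inter_eq_left.2 hsub]
    refine div_pos (weightedVol_pos (isCompact_closedBall _ _) ⟨y, ?_⟩ _)
      (weightedVol_pos (hPc i₀) (hPint i₀) _)
    exact Metric.ball_subset_interior_closedBall (Metric.mem_ball_self (by positivity))
  obtain ⟨ν, hν0, hν⟩ : ∃ ν > 0, ∀ y ∈ T, ν ≤ F y := by
    have hinv : ∀ y ∈ T, 0 ≤ (F y)⁻¹ := fun y hy => (inv_pos.2 (hF0 y hy)).le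
    have hsum := Finset.sum_nonneg hinv
    refine ⟨(1 + ∑ y ∈ T, (F y)⁻¹)⁻¹, by positivity, fun y hy => inv_le_of_inv_le₀ (hF0 y hy) ?_⟩
    linarith [Finset.single_le_sum hinv hy]
  set c := ν / (T.card + 1) * (r / 2) with hc
  have hc0 : 0 < c := by positivity
  set D := n / (t₀ * c) + 1 with hD
  have hD0 : 0 < D := by positivity
  set lo := Real.log (∫ x : EuclideanSpace ℝ (Fin n), Real.exp (-(L * ‖x‖)))
  set hi := Real.log
    (2 * volume.real (Metric.closedBall (0 : EuclideanSpace ℝ (Fin n)) (3 * D)))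
  refine ⟨max |lo| |hi|, ?_⟩
  rintro t ⟨htt, ht1⟩ f hf hconv hrange heq
  have ht0 : 0 < t := ht₀.trans_le htt
  have ht1' : 0 ≤ 1 - t := by linarith
  have hd : ∀ i, Differentiable ℝ (f i) := fun i => (hf i).differentiable (by simp)
  have hfg : ∀ i x, gradient (f i) x ∈ P i := fun i x =>
    hrange i ▸ subset_closure (Set.mem_range_self x)
  have hSP : ∀ i, ∀ y ∈ S i, y ∈ P i := fun i y hy =>
    extremePoints_subset (hS i ▸ (Finset.mem_coe.2 hy))
  set w : EuclideanSpace ℝ (Fin n) → ℝ := fun x => ∑ i, (t * f i x + (1 - t) * h i x) with hw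
  set g := fun i => gradient (f i) with hg
  set a := fun i => logSumExpGrad (S i) with ha
  have hgc : ∀ i, Continuous (g i) := fun i =>
    (differentiable_gradient_of_contDiff (hf i)).continuous
  have hac : ∀ i, Continuous (a i) := fun i => continuous_logSumExpGrad (hSne i)
  have hgR : ∀ i x, ‖g i x‖ ≤ R := fun i x => hR i _ (hfg i x)
  have haR : ∀ i x, ‖a i x‖ ≤ R := fun i x =>
    norm_logSumExpGrad_le (hSne i) (fun y hy => hR i y (hSP i y hy)) x
  have hgsub : ∀ i z x, f i z + ⟪g i z, x - z⟫ ≤ f i x := fun i z x =>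
    (hconv i).convexOn.add_inner_gradient_le (hd i z) x
  have hasub : ∀ i z x, h i z + ⟪a i z, x - z⟫ ≤ h i x := fun i z x => by
    rw [hh, hh]
    exact logSumExp_add_inner_le (hSne i) z x
  have hagrad : ∀ i x, HasGradientAt (h i) (a i x) x := fun i x => by
    rw [funext (hh i)]
    exact hasGradientAt_logSumExp (hSne i) x
  set G : EuclideanSpace ℝ (Fin n) → EuclideanSpace ℝ (Fin n) :=
    fun x => ∑ i, (t • g i x + (1 - t) • a i x) with hG
  have hGc : Continuous G := by fun_prop
  have hGR : ∀ x, ‖G x‖ ≤ L := fun x => by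
    have h1 : ‖G x‖ ≤ ∑ _i : Fin k, R := by
      refine norm_sum_le_of_le _ fun i _ => (norm_add_le _ _).trans ?_
      rw [norm_smul, norm_smul, Real.norm_of_nonneg ht0.le, Real.norm_of_nonneg ht1']
      nlinarith [hgR i x, haR i x]
    rw [Finset.sum_const, Finset.card_univ, Fintype.card_fin, nsmul_eq_mul] at h1
    linarith
  have hwG : ∀ x, HasGradientAt w (G x) x := fun x => by
    rw [hasGradientAt_iff_hasFDerivAt]
    have h1 := HasFDerivAt.fun_sum (u := Finset.univ) fun i _ =>
      ((hd i x).hasGradientAt.hasFDerivAt.const_mul t).add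
        ((hagrad i x).hasFDerivAt.const_mul (1 - t))
    refine h1.congr_fderiv ?_
    simp [hG, hg]
  have hwc : Continuous w := continuous_iff_continuousAt.2 fun x => (hwG x).continuousAt
  have hwLip : ∀ z x, w x ≤ w z + L * ‖x - z‖ := fun z x => by
    have h1 : w x + ⟪G x, z - x⟫ ≤ w z := by
      simp only [hw, hG, sum_inner, ← Finset.sum_add_distrib]
      refine Finset.sum_le_sum fun i _ => ?_
      rw [inner_add_left, real_inner_smul_left, real_inner_smul_left]
      have := mul_le_mul_of_nonneg_left (hgsub i x z) ht0.le
      have := mul_le_mul_of_nonneg_left (hasub i x z) ht1'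
      linarith
    have h2 := (abs_real_inner_le_norm (G x) (z - x)).trans
      (mul_le_mul_of_nonneg_right (hGR x) (norm_nonneg _))
    rw [norm_sub_rev] at h2
    linarith [neg_abs_le ⟪G x, z - x⟫]
  have heq' : ∀ i x, Real.exp ⟪V i, gradient (f i) x⟫ / weightedVol (P i) (V i)
      * hessDet (f i) x = Real.exp (-w x) := fun i x => by
    rw [heq i x, hw]
    simp only [Finset.sum_add_distrib, ← Finset.mul_sum]
    congr 1
    ring
  -- coercivity of `w`
  obtain ⟨γ, hγ, K, hcoer⟩ := exists_mul_norm_sub_le_sum (D := fun i => Set.range (g i)) hzero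
    (fun i => (hrange i).symm.subset) (u := fun i x => t * f i x + (1 - t) * h i x) (by
      rintro i _ ⟨z, rfl⟩
      refine ⟨t * (⟪g i z, z⟫ - f i z) + (1 - t) * Real.log (S i).card, fun x => ?_⟩
      have h1 := mul_le_mul_of_nonneg_left (hgsub i z x) ht0.le
      have h2 := mul_le_mul_of_nonneg_left (inner_sub_log_card_le_logSumExp (hPc i) (hP i) (hS i)
        (hSne i) (hfg i z) x) ht1'
      rw [← hh i x] at h2
      rw [inner_sub_right] at h1
      simp only [hg] at *
      linarith)
  have hint1 := integrable_one_add_norm_mul_exp_neg hwc hγ hcoer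
  have hint : Integrable fun x => Real.exp (-w x) :=
    hint1.mono' (by fun_prop) (Filter.Eventually.of_forall fun x => by
      rw [Real.norm_of_nonneg (Real.exp_pos _).le]
      exact le_mul_of_one_le_left (Real.exp_pos _).le (by linarith [norm_nonneg x]))
  have hmass : ∀ B : Set (EuclideanSpace ℝ (Fin n)), MeasurableSet B →
      ∫ x in g i₀ ⁻¹' B, Real.exp (-w x) =
        weightedVol (B ∩ P i₀) (V i₀) / weightedVol (P i₀) (V i₀) := fun B hB =>
    setIntegral_exp_neg_preimage_gradient (hPc i₀) (hP i₀) (hPint i₀) (V i₀) (hf i₀) (hconv i₀)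
      (hrange i₀) (heq' i₀) hB
  have hone : ∫ x, Real.exp (-w x) = 1 := by
    have := hmass Set.univ MeasurableSet.univ
    rwa [Set.preimage_univ, setIntegral_univ, Set.univ_inter,
      div_self (weightedVol_pos (hPc i₀) (hPint i₀) _).ne'] at this
  set μ : Measure (EuclideanSpace ℝ (Fin n)) :=
    volume.withDensity fun x => ENNReal.ofReal (Real.exp (-w x)) with hμ
  have : IsProbabilityMeasure μ := isProbabilityMeasure_withDensity_exp_neg hint hone
  have hμnorm : Integrable (fun x : EuclideanSpace ℝ (Fin n) => ‖x‖) μ := by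
    rw [hμ, integrable_withDensity_exp_neg_iff hwc.measurable]
    refine (hint1.sub hint).congr (Filter.Eventually.of_forall fun x => ?_)
    simp only [Pi.sub_apply]
    ring
  set b := ∫ y, y ∂μ with hb
  have hgcorr := fun i => integral_inner_sub_mean_nonneg hμnorm (hgc i) (hgR i) fun x y => by
    have h1 := hgsub i x y
    have h2 := hgsub i y x
    rw [← neg_sub, inner_neg_right] at h1
    rw [inner_sub_left]
    linarith
  have hacorr := fun i => integral_inner_sub_mean_nonneg hμnorm (hac i) (haR i) fun x y => by
    have h1 := hasub i x y
    have h2 := hasub i y x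
    rw [← neg_sub, inner_neg_right] at h1
    rw [inner_sub_left]
    linarith
  have hkey := mul_integral_norm_sub_mean_le hμnorm (hd i₀).continuous (hgc i₀) (hgR i₀) (hgsub i₀)
    (by positivity : 0 ≤ r / 2) hTq (ν := ν) fun y hy => by
      rw [hμ, withDensity_exp_neg_real_apply hint
        (Metric.isClosed_closedBall.preimage (hgc i₀)).measurableSet,
        hmass _ Metric.isClosed_closedBall.measurableSet]
      exact hν y hy
  rw [← hb, ← hc] at hkey
  simp only [← hb] at hgcorr hacorr
  have hibp : ∫ x, ⟪G x, x - b⟫ ∂μ = n := by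
    rw [hμ, integral_withDensity_exp_neg hwc.measurable,
      integral_inner_gradient_mul_exp_neg hwG hGc hGR hint1, hone]
    simp
  have hgi := fun i => integrable_inner_sub_of_bounded hμnorm (hgc i) (hgR i) b
  have hai := fun i => integrable_inner_sub_of_bounded hμnorm (hac i) (haR i) b
  have hsum : ∫ x, ⟪G x, x - b⟫ ∂μ =
      ∑ i, (t * ∫ x, ⟪g i x, x - b⟫ ∂μ + (1 - t) * ∫ x, ⟪a i x, x - b⟫ ∂μ) := by
    simp only [hG, sum_inner, inner_add_left, real_inner_smul_left]
    have hti : ∀ i, Integrable (fun x => t * ⟪g i x, x - b⟫ + (1 - t) * ⟪a i x, x - b⟫) μ :=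
      fun i => ((hgi i).const_mul t).add ((hai i).const_mul (1 - t))
    rw [integral_finsetSum _ fun i _ => hti i]
    refine Finset.sum_congr rfl fun i _ => ?_
    rw [integral_add ((hgi i).const_mul t) ((hai i).const_mul (1 - t)), integral_const_mul,
      integral_const_mul]
  have hmom : ∫ x, Real.exp (-w x) * ‖x - b‖ ≤ D := by
    rw [← integral_withDensity_exp_neg hwc.measurable, ← hμ]
    have h1 := Finset.single_le_sum (f := fun i => t * ∫ x, ⟪g i x, x - b⟫ ∂μ +
      (1 - t) * ∫ x, ⟪a i x, x - b⟫ ∂μ)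
      (fun i _ => add_nonneg (mul_nonneg ht0.le (hgcorr i)) (mul_nonneg ht1' (hacorr i)))
      (Finset.mem_univ i₀)
    rw [← hsum, hibp] at h1
    have h2 := mul_nonneg ht1' (hacorr i₀)
    have h3 : t₀ * (c * ∫ x, ‖x - b‖ ∂μ) ≤ n :=
      calc t₀ * (c * ∫ x, ‖x - b‖ ∂μ) ≤ t * (c * ∫ x, ‖x - b‖ ∂μ) := by gcongr
        _ ≤ t * ∫ x, ⟪g i₀ x, x - b⟫ ∂μ := by gcongr
        _ ≤ n := by linarith
    have h4 : ∫ x, ‖x - b‖ ∂μ ≤ n / (t₀ * c) := by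
      rw [le_div_iff₀ (by positivity)]
      linarith
    linarith
  have hmomi : Integrable fun x => Real.exp (-w x) * ‖x - b‖ := by
    rw [← integrable_withDensity_exp_neg_iff hwc.measurable, ← hμ]
    have hid : Integrable (fun x => x) μ := (integrable_norm_iff (by fun_prop)).1 hμnorm
    exact (hid.sub (integrable_const b)).norm
  obtain ⟨x, hx⟩ := exists_le_log_of_integral_norm_sub_le hint hone hD0 hmomi hmom
  have hlow : ∀ z, lo ≤ w z := log_integral_le_of_lipschitz hL0 hwLip hint hone
  have hupper : ⨅ x, w x ≤ hi := (ciInf_le ⟨lo, Set.forall_mem_range.2 hlow⟩ x).trans hx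
  have hlower : lo ≤ ⨅ x, w x := le_ciInf hlow
  exact abs_le_max_abs_abs hlower hupper
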